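/- arXiv:2409.02765 — 2 statements merged into one kernel-verified Lean document; each statement's English description precedes it below -/
import Mathlib

section
/- Let H be a 3-uniform hypergraph containing distinct vertices u and v such that some K₄⁻ of H contains u and v with apex v and some K₄⁻ of H contains u and v with apex u (i.e., the apex digraph D contains the 2-cycle u → v, v → u). Then H contains a homomorphic copy of the tight cycle C₁₁. Equivalently, if H has no homomorphic copy of C₁₁, then the digraph D of apex arcs contains no 2-cycle. -/
open Finset

/-- A 3-uniform hypergraph given by its edge set: every edge has exactly 3 vertices. -/
def IsUniform3 {V : Type*} (H : Finset (Finset V)) : Prop :=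
  ∀ e ∈ H, e.card = 3

/-- The codegree of a pair of vertices: the number of vertices `w` with `{u,v,w} ∈ H`. -/
noncomputable def codeg {V : Type*} [DecidableEq V] (H : Finset (Finset V)) (u v : V) : ℕ :=
  {w : V | ({u, v, w} : Finset V) ∈ H}.ncard

/-- The minimum codegree `δ₂(H)`: the minimum of `codeg H u v` over pairs of distinct vertices. -/
noncomputable def minCodeg {V : Type*} [DecidableEq V] (H : Finset (Finset V)) : ℕ :=
  sInf {d : ℕ | ∃ u v : V, u ≠ v ∧ codeg H u v = d}

/-- `H` contains a homomorphic copy of the tight cycle `C_ℓ`: a cyclic sequence of vertices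
(indexed by `ZMod ℓ`, not necessarily distinct) in which every three cyclically consecutive
vertices are pairwise distinct and form an edge of `H`. -/
def HasHomTightCycle {V : Type*} [DecidableEq V] (ℓ : ℕ) (H : Finset (Finset V)) : Prop :=
  ∃ x : ZMod ℓ → V, ∀ i : ZMod ℓ,
    x (i - 1) ≠ x i ∧ x i ≠ x (i + 1) ∧ x (i - 1) ≠ x (i + 1) ∧
      ({x (i - 1), x i, x (i + 1)} : Finset V) ∈ H

/-- `H` contains a (genuine) copy of the tight cycle `C_ℓ`: `ℓ` distinct vertices, cyclically
ordered, such that every three cyclically consecutive vertices form an edge of `H`. -/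
def HasTightCycle {V : Type*} [DecidableEq V] (ℓ : ℕ) (H : Finset (Finset V)) : Prop :=
  ∃ x : ZMod ℓ → V, Function.Injective x ∧
    ∀ i : ZMod ℓ, ({x (i - 1), x i, x (i + 1)} : Finset V) ∈ H

/-- The arc `u → v` of the apex digraph `D`: some `K₄⁻` of `H` contains `u` and `v`
with apex `v`; i.e. there are two further vertices `a, b` (with `u,v,a,b` distinct)
such that the three edges through `v` on `{u,v,a,b}` all lie in `H`. -/
def ArcD {V : Type*} [DecidableEq V] (H : Finset (Finset V)) (u v : V) : Prop :=
  ∃ a b : V, ({u, v, a, b} : Finset V).card = 4 ∧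
    ({v, u, a} : Finset V) ∈ H ∧ ({v, u, b} : Finset V) ∈ H ∧ ({v, a, b} : Finset V) ∈ H

/-- `{u,v}` is a base pair: some `K₄⁻` of `H` contains `u` and `v` with neither `u` nor
`v` being the apex; i.e. there are further vertices `w, a` (with `u,v,w,a` distinct) with
apex `w`, so that the three edges through `w` on `{u,v,w,a}` all lie in `H`. -/
def BasePair {V : Type*} [DecidableEq V] (H : Finset (Finset V)) (u v : V) : Prop :=
  ∃ w a : V, ({u, v, w, a} : Finset V).card = 4 ∧
    ({w, u, v} : Finset V) ∈ H ∧ ({w, u, a} : Finset V) ∈ H ∧ ({w, v, a} : Finset V) ∈ H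

/-- The degree of `v` in the base-pair graph `B`. -/
noncomputable def degB {V : Type*} [DecidableEq V] (H : Finset (Finset V)) (v : V) : ℕ :=
  {u : V | BasePair H u v}.ncard

/-- The out-degree of `v` in the apex digraph `D`. -/
noncomputable def outDegD {V : Type*} [DecidableEq V] (H : Finset (Finset V)) (v : V) : ℕ :=
  {u : V | ArcD H v u}.ncard

/-- The in-degree of `v` in the apex digraph `D`. -/
noncomputable def inDegD {V : Type*} [DecidableEq V] (H : Finset (Finset V)) (v : V) : ℕ :=
  {u : V | ArcD H u v}.ncard

/-- The codegree Turán number `ex₂(n, C_ℓ)`: the maximum of `δ₂(H)` over all 3-uniform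
hypergraphs `H` on `n` vertices containing no copy of the tight cycle `C_ℓ`. -/
noncomputable def exCodeg (ℓ n : ℕ) : ℕ :=
  sSup {k : ℕ | ∃ H : Finset (Finset (Fin n)),
    IsUniform3 H ∧ ¬ HasTightCycle ℓ H ∧ minCodeg H = k}

/-- The three vertices of an edge of a 3-uniform hypergraph are pairwise distinct. -/
lemma IsUniform3.pairwise_ne {V : Type*} [DecidableEq V] {H : Finset (Finset V)}
    (hH : IsUniform3 H) {p q r : V} (h : ({p, q, r} : Finset V) ∈ H) :
    p ≠ q ∧ q ≠ r ∧ p ≠ r := by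
  have hcard := hH _ h
  refine ⟨?_, ?_, ?_⟩ <;> rintro rfl
  · rw [insert_eq_of_mem (mem_insert_self _ _)] at hcard
    exact absurd (card_le_two (a := p) (b := r)) (by lia)
  · rw [pair_eq_singleton] at hcard
    exact absurd (card_le_two (a := p) (b := q)) (by lia)
  · rw [insert_eq_of_mem (by simp)] at hcard
    exact absurd (card_le_two (a := q) (b := p)) (by lia)

/-- In a 3-uniform hypergraph, a cyclic sequence whose consecutive triples are all edges is a
homomorphic copy of a tight cycle. -/
lemma IsUniform3.hasHomTightCycle {V : Type*} [DecidableEq V] {H : Finset (Finset V)}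
    (hH : IsUniform3 H) {n : ℕ} (x : ZMod n → V)
    (hx : ∀ i, ({x (i - 1), x i, x (i + 1)} : Finset V) ∈ H) :
    HasHomTightCycle n H :=
  ⟨x, fun i =>
    let h := hH.pairwise_ne (hx i)
    ⟨h.1, h.2.1, h.2.2, hx i⟩⟩

/-- If the apex digraph `D` contains a 2-cycle `u → v`, `v → u`, then `H` contains a
homomorphic copy of the tight cycle `C₁₁`; equivalently, if `H` has no homomorphic copy
of `C₁₁`, then `D` has no 2-cycle. -/
theorem two_cycle_gives_homC11 {V : Type*} [DecidableEq V]
    (H : Finset (Finset V)) (hH : IsUniform3 H) (u v : V) (huv : u ≠ v)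
    (h1 : ArcD H u v) (h2 : ArcD H v u) :
    HasHomTightCycle 11 H := by
  obtain ⟨a, b, -, hvua, hvub, hvab⟩ := h1
  obtain ⟨c, d, -, huvc, huvd, hucd⟩ := h2
  have rot : ∀ {p q r : V}, ({p, q, r} : Finset V) ∈ H → ({q, r, p} : Finset V) ∈ H := by
    intro p q r h
    rwa [insert_comm, pair_comm p r] at h
  have swap : ∀ {p q r : V}, ({p, q, r} : Finset V) ∈ H → ({q, p, r} : Finset V) ∈ H := by
    intro p q r h
    rwa [insert_comm] at h
  let x : Fin 11 → V := ![u, v, a, u, v, a, b, v, u, c, d]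
  refine hH.hasHomTightCycle (n := 11) x fun i => ?_
  fin_cases i
  · exact rot (rot huvd)
  · exact swap hvua
  · exact rot (swap hvua)
  · exact rot (rot (swap hvua))
  · exact swap hvua
  · exact hvab
  · exact rot hvab
  · exact rot (rot hvub)
  · exact swap huvc
  · exact hucd
  · exact rot hucd
end

section
/- Let H be a 3-uniform hypergraph containing no homomorphic copy of the tight cycle C₁₁. Then for every vertex v of H, the three sets N_B(v) = {u : {u,v} is a base pair}, N_D⁺(v) = {u : v → u in D}, and N_D⁻(v) = {u : u → v in D} are pairwise disjoint. -/
open Finset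

lemma insert_pair_mem_rotate {V : Type*} [DecidableEq V] {H : Finset (Finset V)} {p q r : V}
    (h : ({p, q, r} : Finset V) ∈ H) : ({q, r, p} : Finset V) ∈ H := by
  rwa [Finset.pair_comm, Finset.insert_comm]

lemma insert_pair_mem_swap {V : Type*} [DecidableEq V] {H : Finset (Finset V)} {p q r : V}
    (h : ({p, q, r} : Finset V) ∈ H) : ({p, r, q} : Finset V) ∈ H := by
  rwa [Finset.pair_comm]

/-- In a 3-uniform hypergraph, the distinctness conditions of a homomorphic tight cycle are
automatic. -/
lemma hasHomTightCycle_of_forall_mem {V : Type*} [DecidableEq V] {ℓ : ℕ} {H : Finset (Finset V)}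
    (hH : IsUniform3 H) (x : ZMod ℓ → V)
    (hx : ∀ i, ({x (i - 1), x i, x (i + 1)} : Finset V) ∈ H) : HasHomTightCycle ℓ H := by
  refine ⟨x, fun i => ?_⟩
  have hcard : ∀ {p q r : V}, ({p, q, r} : Finset V) ∈ H → p ≠ q ∧ p ≠ r ∧ q ≠ r :=
    fun h => Finset.card_triple_eq_three_iff.mp (hH _ h)
  obtain ⟨h₁, h₂, h₃⟩ := hcard (hx i)
  exact ⟨h₁, h₃, h₂, hx i⟩

lemma BasePair.symm {V : Type*} [DecidableEq V] {H : Finset (Finset V)} {u v : V}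
    (h : BasePair H u v) : BasePair H v u := by
  obtain ⟨w, a, hcard, h₁, h₂, h₃⟩ := h
  refine ⟨w, a, ?_, ?_, h₃, h₂⟩
  · rwa [Finset.insert_comm]
  · rwa [Finset.pair_comm]

/-- A base pair that is also an arc yields a homomorphic `C₁₁`. -/
lemma BasePair.hasHomTightCycle_of_arcD {V : Type*} [DecidableEq V] {H : Finset (Finset V)}
    (hH : IsUniform3 H) {u v : V} (hB : BasePair H u v) (hD : ArcD H v u) :
    HasHomTightCycle 11 H := by
  obtain ⟨w, a, -, hwuv, hwua, hwva⟩ := hB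
  obtain ⟨c, d, -, huvc, huvd, hucd⟩ := hD
  refine hasHomTightCycle_of_forall_mem hH
    (![a, v, w, u, v, c, u, d, v, u, w] : Fin 11 → V) fun i => ?_
  change Fin 11 at i
  fin_cases i
  exacts [
    insert_pair_mem_swap hwva,
    insert_pair_mem_swap (insert_pair_mem_rotate (insert_pair_mem_rotate hwva)),
    insert_pair_mem_rotate (insert_pair_mem_rotate hwuv),
    hwuv,
    huvc,
    insert_pair_mem_rotate huvc,
    insert_pair_mem_swap (insert_pair_mem_rotate hucd),
    insert_pair_mem_swap huvd,
    insert_pair_mem_swap (insert_pair_mem_rotate (insert_pair_mem_rotate huvd)),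
    insert_pair_mem_swap (insert_pair_mem_rotate (insert_pair_mem_rotate hwuv)),
    insert_pair_mem_swap (insert_pair_mem_rotate hwua)]

/-- A pair of opposite arcs yields a homomorphic `C₁₁`. -/
lemma ArcD.hasHomTightCycle_of_arcD {V : Type*} [DecidableEq V] {H : Finset (Finset V)}
    (hH : IsUniform3 H) {u v : V} (huv : ArcD H v u) (hvu : ArcD H u v) :
    HasHomTightCycle 11 H := by
  obtain ⟨a, b, -, huva, huvb, huab⟩ := huv
  obtain ⟨c, d, -, hvuc, hvud, hvcd⟩ := hvu
  refine hasHomTightCycle_of_forall_mem hH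
    (![a, b, u, a, b, u, v, c, d, v, u] : Fin 11 → V) fun i => ?_
  change Fin 11 at i
  fin_cases i
  exacts [
    huab,
    insert_pair_mem_rotate huab,
    insert_pair_mem_rotate (insert_pair_mem_rotate huab),
    huab,
    insert_pair_mem_rotate huab,
    insert_pair_mem_rotate (insert_pair_mem_rotate huvb),
    insert_pair_mem_swap (insert_pair_mem_rotate hvuc),
    hvcd,
    insert_pair_mem_rotate hvcd,
    insert_pair_mem_rotate (insert_pair_mem_rotate hvud),
    insert_pair_mem_swap (insert_pair_mem_rotate huva)]

/-- If `H` has no homomorphic copy of the tight cycle `C₁₁`, then for every vertex `v`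
the sets `N_B(v)`, `N_D⁺(v)` and `N_D⁻(v)` are pairwise disjoint. -/
theorem neighborhoods_pairwise_disjoint {V : Type*} [DecidableEq V]
    (H : Finset (Finset V)) (hH : IsUniform3 H)
    (hfree : ¬ HasHomTightCycle 11 H) :
    ∀ v : V,
      Disjoint {u : V | BasePair H u v} {u : V | ArcD H v u} ∧
      Disjoint {u : V | BasePair H u v} {u : V | ArcD H u v} ∧
      Disjoint {u : V | ArcD H v u} {u : V | ArcD H u v} := by
  intro v
  simp only [Set.disjoint_left, Set.mem_ofPred_eq]
  exact ⟨fun u hB hD => hfree (hB.hasHomTightCycle_of_arcD hH hD),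
    fun u hB hD => hfree (hB.symm.hasHomTightCycle_of_arcD hH hD),
    fun u huv hvu => hfree (huv.hasHomTightCycle_of_arcD hH hvu)⟩
end
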